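/- Let w ∈ W be in reduced form and satisfy Hypothesis (L). Then w(n) ≠ n. -/

import Mathlib

/-!  Common framework: Weyl groups of classical groups, modeled as permutations of ℕ
supported on `{1,…,r₀}`, with the convention `i' = r₀ + 1 - i`. -/

/-- `IsWfull r₀ w`: `w` fixes every point outside `{1,…,r₀}` and commutes with the
involution `ι : i ↦ r₀ + 1 - i` on `{1,…,r₀}`.  This is the full group of permutations
of `{1,…,r₀}` commuting with `ι` (the Weyl group of `SO(2r+1)`, `U(2r+1)` or `U(2r)`). -/
def IsWfull (r₀ : ℕ) (w : Equiv.Perm ℕ) : Prop :=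
  (∀ i : ℕ, ¬(1 ≤ i ∧ i ≤ r₀) → w i = i) ∧
  (∀ i : ℕ, 1 ≤ i → i ≤ r₀ → w (r₀ + 1 - i) = r₀ + 1 - w i)

/-- The parity condition singling out the Weyl group of `SO(2r)`:
the number of indices `1 ≤ i ≤ r` with `w i > r` is even. -/
def EvenCond (r : ℕ) (w : Equiv.Perm ℕ) : Prop :=
  Even (((Finset.Icc 1 r).filter (fun i => r < w i)).card)

/-- Membership in `W`; the proposition `so2r` indicates whether we are in the `SO(2r)`
case (where the parity condition is imposed on top of `IsWfull`). -/
def MemW (r r₀ : ℕ) (so2r : Prop) (w : Equiv.Perm ℕ) : Prop :=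
  IsWfull r₀ w ∧ (so2r → EvenCond r w)

/-- Membership in `W_M`: an element of `W` with `w({1,…,n}) = {1,…,n}` and
`w({n+1,…,r₀−n}) = {n+1,…,r₀−n}`. -/
def MemWM (r r₀ n : ℕ) (so2r : Prop) (m : Equiv.Perm ℕ) : Prop :=
  MemW r r₀ so2r m ∧
  (Finset.Icc 1 n).image (fun i => m i) = Finset.Icc 1 n ∧
  (Finset.Icc (n + 1) (r₀ - n)).image (fun i => m i) = Finset.Icc (n + 1) (r₀ - n)

/-- The left coset `w·{m | P m}`. -/
def coset (P : Equiv.Perm ℕ → Prop) (w : Equiv.Perm ℕ) : Set (Equiv.Perm ℕ) :=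
  {x | ∃ m, P m ∧ x = w * m}

/-- `w` is in standard form: a product of pairwise disjoint transpositions
`∏ᵢ (aᵢ aᵢ') · ∏ᵢ (bᵢ cᵢ)(cᵢ' bᵢ')` with `aᵢ, bᵢ ∈ {1,…,n}` and `cᵢ ∈ {n+1,…,r₀−n}`.
This is encoded pointwise: `w` belongs to the full group `W`, is an involution, every
moved point `i ∈ {1,…,n}` has `w i = i'` or `w i ∈ {n+1,…,r₀−n}`, and every moved
point `i ∈ {n+1,…,r₀−n}` has `w i ∈ {1,…,n}` or `w i ∈ {n',…,r₀}`. -/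
def IsStandardForm (r₀ n : ℕ) (w : Equiv.Perm ℕ) : Prop :=
  IsWfull r₀ w ∧ w * w = 1 ∧
  (∀ i, 1 ≤ i → i ≤ n → w i ≠ i →
    (w i = r₀ + 1 - i ∨ (n + 1 ≤ w i ∧ w i ≤ r₀ - n))) ∧
  (∀ i, n + 1 ≤ i → i ≤ r₀ - n → w i ≠ i →
    (w i ≤ n ∨ r₀ + 1 - n ≤ w i))

/-- The 4-cycle `(a b c d)` sending `a ↦ b ↦ c ↦ d ↦ a`. -/
def cycle4 (a b c d : ℕ) : Equiv.Perm ℕ :=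
  Equiv.swap a b * Equiv.swap b c * Equiv.swap c d

/-- `w` is in reduced form: `w = w₁ w₂` with `w₁` in standard form, `w₂` disjoint from
`w₁`, and `w₂` either the identity, or (only in the `SO(2r)` case) a transposition
`(d₀ d₀')` with `n+1 ≤ d₀ ≤ r`, or a 4-cycle `(i₀ j₀' i₀' j₀)` with `1 ≤ i₀ ≤ n < j₀ ≤ r`. -/
def IsReducedForm (r r₀ n : ℕ) (so2r : Prop) (w : Equiv.Perm ℕ) : Prop :=
  ∃ w₁ w₂ : Equiv.Perm ℕ,
    IsStandardForm r₀ n w₁ ∧ w = w₁ * w₂ ∧ Equiv.Perm.Disjoint w₁ w₂ ∧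
    (w₂ = 1 ∨
      (so2r ∧
        ((∃ d₀, n + 1 ≤ d₀ ∧ d₀ ≤ r ∧ w₂ = Equiv.swap d₀ (r₀ + 1 - d₀)) ∨
         (∃ i₀ j₀, 1 ≤ i₀ ∧ i₀ ≤ n ∧ n < j₀ ∧ j₀ ≤ r ∧
            w₂ = cycle4 i₀ (r₀ + 1 - j₀) (r₀ + 1 - i₀) j₀))))

/-- The vector `e_i : {1,…,r₀} → ℤ` with `e_i(i) = 1`, `e_i(i') = −1`, `0` elsewhere. -/
def evec (r₀ i : ℕ) : ℕ → ℤ :=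
  fun k => if k = i then 1 else if k = r₀ + 1 - i then -1 else 0

/-- The simple root `α_i = e_i − e_{i+1}`. -/
def rootAlpha (r₀ i : ℕ) : ℕ → ℤ := evec r₀ i - evec r₀ (i + 1)

/-- The root `β = e_ℓ + e_{ℓ+1}`. -/
def rootBeta (r₀ l : ℕ) : ℕ → ℤ := evec r₀ l + evec r₀ (l + 1)

/-- The action of `w` on root vectors: `(w·v)(k) = v(w⁻¹ k)`. -/
def pact (w : Equiv.Perm ℕ) (v : ℕ → ℤ) : ℕ → ℤ := fun k => v (w⁻¹ k)

/-- The set `X = {α_1,…,α_ℓ, β}`. -/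
def Xset (r₀ l : ℕ) : Set (ℕ → ℤ) :=
  {v | (∃ i, 1 ≤ i ∧ i ≤ l ∧ v = rootAlpha r₀ i) ∨ v = rootBeta r₀ l}

/-- The set of short and long roots `{e_i, 2e_i : 1 ≤ i ≤ n}` from which `S₀` is drawn. -/
def ShortLong (r₀ n : ℕ) : Set (ℕ → ℤ) :=
  {v | ∃ i, 1 ≤ i ∧ i ≤ n ∧ (v = evec r₀ i ∨ v = evec r₀ i + evec r₀ i)}

/-- `Σ_P^+ = {e_i ± e_j : 1 ≤ i ≤ n < j ≤ r} ∪ {e_i + e_j : 1 ≤ i < j ≤ n} ∪ S₀`. -/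
def SigmaP (r r₀ n : ℕ) (S₀ : Set (ℕ → ℤ)) : Set (ℕ → ℤ) :=
  {v | ∃ i j, 1 ≤ i ∧ i ≤ n ∧ n < j ∧ j ≤ r ∧
        (v = evec r₀ i - evec r₀ j ∨ v = evec r₀ i + evec r₀ j)} ∪
  {v | ∃ i j, 1 ≤ i ∧ i < j ∧ j ≤ n ∧ v = evec r₀ i + evec r₀ j} ∪ S₀

/-- Hypothesis (E): `w·α ∉ X` for every `α ∈ Σ_P^+`. -/
def HypE (r r₀ n l : ℕ) (S₀ : Set (ℕ → ℤ)) (w : Equiv.Perm ℕ) : Prop :=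
  ∀ α ∈ SigmaP r r₀ n S₀, pact w α ∉ Xset r₀ l

/-- Hypothesis (L): `α_ℓ = w·α` for some `α ∈ Σ_P^+`; no other element of `X` is of the
form `w·α` with `α ∈ Σ_P^+`; and `w⁻¹·α_ℓ` is not of the form `e_i + e_j` with
`1 ≤ i, j ≤ n`. -/
def HypL (r r₀ n l : ℕ) (S₀ : Set (ℕ → ℤ)) (w : Equiv.Perm ℕ) : Prop :=
  (∃ α ∈ SigmaP r r₀ n S₀, pact w α = rootAlpha r₀ l) ∧
  (∀ α ∈ SigmaP r r₀ n S₀, pact w α ∈ Xset r₀ l → pact w α = rootAlpha r₀ l) ∧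
  ¬ ∃ i j, 1 ≤ i ∧ i ≤ n ∧ 1 ≤ j ∧ j ≤ n ∧
      pact w⁻¹ (rootAlpha r₀ l) = evec r₀ i + evec r₀ j

/-- The permutation `(1 r₀)(2 r₀−1)⋯(n n')`. -/
def w0base (r₀ n : ℕ) : Equiv.Perm ℕ :=
  (((List.range n).map (fun i => Equiv.swap (i + 1) (r₀ - i))).prod)

lemma perm_apply_inv_self {α : Type*} (f : Equiv.Perm α) (x : α) : f (f⁻¹ x) = x :=
  f.apply_symm_apply x

lemma IsWfull.apply_mem {r₀ : ℕ} {w : Equiv.Perm ℕ} (hw : IsWfull r₀ w) {i : ℕ}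
    (h1 : 1 ≤ i) (h2 : i ≤ r₀) : 1 ≤ w i ∧ w i ≤ r₀ := by
  by_contra h
  have := w.injective (hw.1 (w i) h)
  omega

lemma IsWfull.symm_apply_mem {r₀ : ℕ} {w : Equiv.Perm ℕ} (hw : IsWfull r₀ w) {i : ℕ}
    (h1 : 1 ≤ i) (h2 : i ≤ r₀) : 1 ≤ w⁻¹ i ∧ w⁻¹ i ≤ r₀ := by
  by_contra h
  have := hw.1 (w⁻¹ i) h
  rw [perm_apply_inv_self] at this
  omega

lemma pact_sub (w : Equiv.Perm ℕ) (u v : ℕ → ℤ) : pact w (u - v) = pact w u - pact w v := rfl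

lemma pact_add (w : Equiv.Perm ℕ) (u v : ℕ → ℤ) : pact w (u + v) = pact w u + pact w v := rfl

lemma pact_inv_pact (w : Equiv.Perm ℕ) (v : ℕ → ℤ) : pact w⁻¹ (pact w v) = v := by
  funext k
  simp [pact]

lemma pact_evec {r₀ : ℕ} {w : Equiv.Perm ℕ} (hw : IsWfull r₀ w) {i : ℕ}
    (h1 : 1 ≤ i) (h2 : i ≤ r₀) : pact w (evec r₀ i) = evec r₀ (w i) := by
  funext k
  simp only [pact, evec, Equiv.Perm.inv_eq_iff_eq, hw.2 i h1 h2]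

lemma pact_evec_inv {r₀ : ℕ} {w : Equiv.Perm ℕ} (hw : IsWfull r₀ w) {i : ℕ}
    (h1 : 1 ≤ i) (h2 : i ≤ r₀) : pact w (evec r₀ (w⁻¹ i)) = evec r₀ i := by
  obtain ⟨h3, h4⟩ := hw.symm_apply_mem h1 h2
  rw [pact_evec hw h3 h4, perm_apply_inv_self]

lemma evec_reflect {r₀ i : ℕ} (h1 : 1 ≤ i) (h2 : i ≤ r₀) (h : 2 * i ≠ r₀ + 1) :
    evec r₀ (r₀ + 1 - i) = -evec r₀ i := by
  funext k
  simp only [evec, Pi.neg_apply]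
  split_ifs <;> omega

/-- The preimage under `w` of an index different from its mirror image differs from its own
mirror image. -/
lemma IsWfull.two_mul_symm_apply_ne {r₀ : ℕ} {w : Equiv.Perm ℕ} (hw : IsWfull r₀ w) {i : ℕ}
    (h1 : 1 ≤ i) (h2 : i ≤ r₀) (h : 2 * i ≠ r₀ + 1) : 2 * w⁻¹ i ≠ r₀ + 1 := by
  intro he
  obtain ⟨h3, h4⟩ := hw.symm_apply_mem h1 h2
  have h5 := hw.2 _ h3 h4
  rw [show r₀ + 1 - w⁻¹ i = w⁻¹ i by omega, perm_apply_inv_self] at h5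
  omega

lemma add_sub_mem_SigmaP {r r₀ n x y : ℕ} (S₀ : Set (ℕ → ℤ))
    (hr₀ : r₀ = 2 * r ∨ r₀ = 2 * r + 1) (hx1 : 1 ≤ x) (hxn : x ≤ n)
    (hyn : n < y) (hyn' : y ≤ r₀ - n) (hy : 2 * y ≠ r₀ + 1) :
    evec r₀ x - evec r₀ y ∈ SigmaP r r₀ n S₀ ∧ evec r₀ x + evec r₀ y ∈ SigmaP r r₀ n S₀ := by
  rcases le_or_gt y r with h | h
  · exact ⟨.inl (.inl ⟨x, y, hx1, hxn, hyn, h, .inl rfl⟩),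
      .inl (.inl ⟨x, y, hx1, hxn, hyn, h, .inr rfl⟩)⟩
  · have e := evec_reflect (r₀ := r₀) (i := y) (by omega) (by omega) hy
    exact ⟨.inl (.inl ⟨x, r₀ + 1 - y, hx1, hxn, by omega, by omega,
        .inr (by rw [e, sub_eq_add_neg])⟩),
      .inl (.inl ⟨x, r₀ + 1 - y, hx1, hxn, by omega, by omega,
        .inl (by rw [e, sub_neg_eq_add])⟩)⟩

lemma sum_evec {r₀ n i : ℕ} (hn : 2 * n ≤ r₀) (hi : i ≤ r₀ - n) :
    ∑ k ∈ Finset.Icc 1 n, evec r₀ i k = if 1 ≤ i ∧ i ≤ n then 1 else 0 := by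
  have h : ∀ k ∈ Finset.Icc 1 n, evec r₀ i k = if k = i then 1 else 0 := by
    intro k hk
    rw [Finset.mem_Icc] at hk
    simp only [evec]
    split_ifs <;> omega
  rw [Finset.sum_congr rfl h, Finset.sum_ite_eq']
  simp only [Finset.mem_Icc]

/-- The first `n` coordinates of a root in `Σ_P^+` have positive sum. -/
lemma sum_pos_of_mem_SigmaP {r r₀ n : ℕ} {S₀ : Set (ℕ → ℤ)} (hr₀ : 2 * r ≤ r₀) (hn : n ≤ r)
    (hS₀ : S₀ ⊆ ShortLong r₀ n) {v : ℕ → ℤ} (hv : v ∈ SigmaP r r₀ n S₀) :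
    0 < ∑ k ∈ Finset.Icc 1 n, v k := by
  have key : ∀ i, i ≤ r →
      ∑ k ∈ Finset.Icc 1 n, evec r₀ i k = if 1 ≤ i ∧ i ≤ n then 1 else 0 :=
    fun i hi => sum_evec (by omega) (by omega)
  rcases hv with (⟨i, j, h1, h2, h3, h4, rfl | rfl⟩ | ⟨i, j, h1, h2, h3, rfl⟩) | hv
  · simp only [Pi.sub_apply, Finset.sum_sub_distrib, key i (by omega), key j h4]
    split_ifs <;> omega
  · simp only [Pi.add_apply, Finset.sum_add_distrib, key i (by omega), key j h4]
    split_ifs <;> omega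
  · simp only [Pi.add_apply, Finset.sum_add_distrib, key i (by omega), key j (by omega)]
    split_ifs <;> omega
  · obtain ⟨i, h1, h2, rfl | rfl⟩ := hS₀ hv
    · rw [key i (by omega)]
      split_ifs <;> omega
    · simp only [Pi.add_apply, Finset.sum_add_distrib, key i (by omega)]
      split_ifs <;> omega

lemma pact_sub_evec_inv {r₀ k : ℕ} {w : Equiv.Perm ℕ} (hw : IsWfull r₀ w)
    (h1 : 1 ≤ k) (h2 : k + 1 ≤ r₀) :
    pact w (evec r₀ (w⁻¹ k) - evec r₀ (w⁻¹ (k + 1))) = rootAlpha r₀ k := by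
  rw [pact_sub, pact_evec_inv hw h1 (by omega), pact_evec_inv hw (by omega) h2, rootAlpha]

lemma pact_add_evec_inv {r₀ k : ℕ} {w : Equiv.Perm ℕ} (hw : IsWfull r₀ w)
    (h1 : 1 ≤ k) (h2 : k + 1 ≤ r₀) :
    pact w (evec r₀ (w⁻¹ k) + evec r₀ (w⁻¹ (k + 1))) = rootBeta r₀ k := by
  rw [pact_add, pact_evec_inv hw h1 (by omega), pact_evec_inv hw (by omega) h2, rootBeta]

lemma rootAlpha_ne {r₀ k l : ℕ} (hk : k < l) (hl : 2 * (l + 1) ≤ r₀) :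
    rootAlpha r₀ k ≠ rootAlpha r₀ l := by
  intro h
  have := congrFun h k
  simp only [rootAlpha, evec, Pi.sub_apply] at this
  split_ifs at this <;> omega

lemma rootBeta_ne_rootAlpha {r₀ l : ℕ} :
    rootBeta r₀ l ≠ rootAlpha r₀ l := by
  intro h
  have := congrFun h (l + 1)
  simp only [rootAlpha, rootBeta, evec, Pi.sub_apply, Pi.add_apply] at this
  split_ifs at this <;> omega

/-- If `w` fixes `n` and no `α_k` with `n ≤ k < ℓ` lies in `w·Σ_P^+`, then `w⁻¹` sends
`{n,…,ℓ}` into `{1,…,n}`. -/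
lemma symm_apply_le_of_apply_eq {r n ℓ r₀ : ℕ} (hn : 1 ≤ n) (hlr : ℓ + 1 ≤ r)
    (hr₀ : r₀ = 2 * r ∨ r₀ = 2 * r + 1) {S₀ : Set (ℕ → ℤ)} {w : Equiv.Perm ℕ}
    (hw : IsWfull r₀ w)
    (hα : ∀ α ∈ SigmaP r r₀ n S₀, pact w α ∈ Xset r₀ ℓ → pact w α = rootAlpha r₀ ℓ)
    (h : w n = n) {k : ℕ} (hk : n ≤ k) (hkl : k ≤ ℓ) : w⁻¹ k ≤ n := by
  induction k, hk using Nat.le_induction with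
  | base => rw [Equiv.Perm.inv_eq_iff_eq.2 h.symm]
  | succ k hk ih =>
    have hx := ih (by omega)
    obtain ⟨hx1, -⟩ := hw.symm_apply_mem (i := k) (by omega) (by omega)
    obtain ⟨hy1, hy2⟩ := hw.symm_apply_mem (i := k + 1) (by omega) (by omega)
    have hy := hw.two_mul_symm_apply_ne (i := k + 1) (by omega) (by omega) (by omega)
    have hnot : evec r₀ (w⁻¹ k) - evec r₀ (w⁻¹ (k + 1)) ∉ SigmaP r r₀ n S₀ := by
      intro hm
      have hp := pact_sub_evec_inv (k := k) hw (by omega) (by omega)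
      have := hα _ hm (hp ▸ .inl ⟨k, by omega, by omega, rfl⟩)
      exact rootAlpha_ne (by omega) (by omega) (hp.symm.trans this)
    by_contra hyn
    apply hnot
    by_cases hmid : w⁻¹ (k + 1) ≤ r₀ - n
    · exact (add_sub_mem_SigmaP S₀ hr₀ hx1 hx (by omega) hmid hy).1
    have e := evec_reflect hy1 hy2 hy
    rw [sub_eq_add_neg, ← e]
    have hne : w⁻¹ k ≠ r₀ + 1 - w⁻¹ (k + 1) := by
      intro he
      have h5 := hw.2 _ hy1 hy2
      rw [← he, perm_apply_inv_self, perm_apply_inv_self] at h5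
      omega
    rcases lt_or_gt_of_ne hne with hlt | hlt
    · exact .inl (.inr ⟨_, _, hx1, hlt, by omega, rfl⟩)
    · exact .inl (.inr ⟨_, _, by omega, hlt, hx, add_comm _ _⟩)

/-- if `w ∈ W` is in reduced form and satisfies Hypothesis (L), then
`w n ≠ n`. -/
theorem stmt13 (r n ℓ r₀ : ℕ) (so2r : Prop)
    (hn : 1 ≤ n) (hnl : n ≤ ℓ) (hlr : ℓ + 1 ≤ r)
    (hr₀ : r₀ = 2 * r ∨ r₀ = 2 * r + 1) (hso : so2r → r₀ = 2 * r)
    (S₀ : Set (ℕ → ℤ)) (hS₀ : S₀ ⊆ ShortLong r₀ n)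
    (w : Equiv.Perm ℕ) (hw : MemW r r₀ so2r w)
    (hred : IsReducedForm r r₀ n so2r w)
    (hL : HypL r r₀ n ℓ S₀ w) :
    w n ≠ n := by
  intro h
  have hW := hw.1
  obtain ⟨⟨α, hαm, hα⟩, hX, hN⟩ := hL
  have hx := symm_apply_le_of_apply_eq hn hlr hr₀ hW hX h hnl le_rfl
  obtain ⟨hx1, -⟩ := hW.symm_apply_mem (i := ℓ) (by omega) (by omega)
  obtain ⟨hy1, hy2⟩ := hW.symm_apply_mem (i := ℓ + 1) (by omega) (by omega)
  have hy := hW.two_mul_symm_apply_ne (i := ℓ + 1) (by omega) (by omega) (by omega)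
  have hp := pact_sub_evec_inv (k := ℓ) hW (by omega) (by omega)
  have hinv : pact w⁻¹ (rootAlpha r₀ ℓ) = evec r₀ (w⁻¹ ℓ) - evec r₀ (w⁻¹ (ℓ + 1)) := by
    rw [← hp, pact_inv_pact]
  rw [← pact_inv_pact w α, hα, hinv] at hαm
  have hyn : n < w⁻¹ (ℓ + 1) := by
    by_contra hle
    have hpos := sum_pos_of_mem_SigmaP (by omega) (by omega) hS₀ hαm
    simp only [Pi.sub_apply, Finset.sum_sub_distrib] at hpos
    rw [sum_evec (by omega) (by omega), sum_evec (by omega) (by omega),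
      if_pos ⟨hx1, hx⟩, if_pos ⟨hy1, by omega⟩] at hpos
    omega
  have hyn' : w⁻¹ (ℓ + 1) ≤ r₀ - n := by
    by_contra hgt
    refine hN ⟨w⁻¹ ℓ, r₀ + 1 - w⁻¹ (ℓ + 1), hx1, hx, by omega, by omega, ?_⟩
    rw [hinv, evec_reflect hy1 hy2 hy, sub_eq_add_neg]
  have hβ := pact_add_evec_inv (k := ℓ) hW (by omega) (by omega)
  have := hX _ (add_sub_mem_SigmaP S₀ hr₀ hx1 hx hyn hyn' hy).2 (hβ ▸ .inr rfl)
  exact rootBeta_ne_rootAlpha (hβ.symm.trans this)
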